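/- Suppose an ideal 𝓘 of graphs, together with the ideal 𝓘₂ of complements of members of 𝓘, has the property that for some ε, c₀ > 0, every graph G ∈ 𝓘 for which one of G, Ḡ is ε-coherent satisfies ω(G)·α(G) ≥ |G|^{c₀}, and 𝓘 is proper (there is a graph H not in 𝓘). Then there exists c > 0 such that every G ∈ 𝓘 satisfies ω(G)·α(G) ≥ |G|^c. -/

import Mathlib

/-- A finite graph, presented as a number of vertices together with a graph on `Fin n`. -/
abbrev GraphOn := Σ n : ℕ, SimpleGraph (Fin n)

/-- `H` is (isomorphic to) an induced subgraph of `G`. -/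
def Embeds (H G : GraphOn) : Prop :=
  ∃ f : Fin H.1 → Fin G.1, Function.Injective f ∧
    ∀ a b, H.2.Adj a b ↔ G.2.Adj (f a) (f b)

/-- An ideal: a class of finite graphs closed under (isomorphism and) induced subgraphs. -/
def IsIdeal (I : Set GraphOn) : Prop :=
  ∀ G ∈ I, ∀ H : GraphOn, Embeds H G → H ∈ I

/-- The clique number ω(G). -/
noncomputable def gOmega (G : GraphOn) : ℕ :=
  sSup {k | ∃ s : Finset (Fin G.1), G.2.IsNClique k s}

/-- The independence number α(G). -/
noncomputable def gAlpha (G : GraphOn) : ℕ :=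
  sSup {k | ∃ s : Finset (Fin G.1), G.2ᶜ.IsNClique k s}

/-- Complementation on `GraphOn`. -/
def gCompl (G : GraphOn) : GraphOn := ⟨G.1, G.2ᶜ⟩

/-- `G` is ε-coherent: at least two vertices, all degrees less than `ε|G|`, and every
pair of disjoint anticomplete sets `A, B` has `min(|A|,|B|) < ε|G|`. -/
def Coherent {n : ℕ} (G : SimpleGraph (Fin n)) (ε : ℝ) : Prop :=
  2 ≤ n ∧ (∀ v, ((G.neighborSet v).ncard : ℝ) < ε * n) ∧
  ∀ A B : Finset (Fin n), Disjoint A B → (∀ a ∈ A, ∀ b ∈ B, ¬ G.Adj a b) →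
    (min A.card B.card : ℝ) < ε * n


open Classical in
/-- number of ordered pairs -/
noncomputable def eCount {n : ℕ} (G : SimpleGraph (Fin n)) (X Y : Finset (Fin n)) : ℝ :=
  ∑ x ∈ X, ∑ y ∈ Y, if G.Adj x y then (1 : ℝ) else 0

lemma eCount_mono {n : ℕ} (G : SimpleGraph (Fin n)) {X Y A B : Finset (Fin n)}
    (h : X ⊆ A) (h' : Y ⊆ B) : eCount G X Y ≤ eCount G A B := by
  unfold eCount
  refine (Finset.sum_le_sum fun x _ => Finset.sum_le_sum_of_subset_of_nonneg h' ?_).trans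
    (Finset.sum_le_sum_of_subset_of_nonneg h ?_)
  · intros; split_ifs <;> norm_num
  · intros; apply Finset.sum_nonneg; intros; split_ifs <;> norm_num

lemma eCount_comm {n : ℕ} (G : SimpleGraph (Fin n)) (X Y : Finset (Fin n)) :
    eCount G X Y = eCount G Y X := by
  classical
  unfold eCount
  rw [Finset.sum_comm]
  exact Finset.sum_congr rfl fun _ _ => Finset.sum_congr rfl fun _ _ =>
    if_congr (G.adj_comm _ _) rfl rfl

lemma eCount_union_left {n : ℕ} (G : SimpleGraph (Fin n)) {X Y : Finset (Fin n)}
    (h : Disjoint X Y) (Z : Finset (Fin n)) :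
    eCount G (X ∪ Y) Z = eCount G X Z + eCount G Y Z := by
  unfold eCount
  rw [Finset.sum_union h]

lemma eCount_union {n : ℕ} (G : SimpleGraph (Fin n)) {X Y : Finset (Fin n)}
    (h : Disjoint X Y) :
    eCount G (X ∪ Y) (X ∪ Y) = eCount G X X + eCount G Y Y + 2 * eCount G X Y := by
  rw [eCount_union_left G h, eCount_comm G X, eCount_comm G Y, eCount_union_left G h,
    eCount_union_left G h, eCount_comm G Y X]
  ring

lemma eCount_singleton {n : ℕ} (G : SimpleGraph (Fin n)) (v : Fin n) :
    eCount G {v} {v} = 0 := by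
  simp [eCount]

lemma eCount_le {n : ℕ} (G : SimpleGraph (Fin n)) (X : Finset (Fin n)) :
    eCount G X X ≤ X.card * (X.card - 1) := by
  classical
  unfold eCount
  have : ∀ x ∈ X, (∑ y ∈ X, if G.Adj x y then (1 : ℝ) else 0) ≤ X.card - 1 := by
    intro x hx
    rw [← Finset.add_sum_erase _ _ hx]
    simp only [SimpleGraph.irrefl, if_false, zero_add]
    calc _ ≤ ∑ y ∈ X.erase x, (1 : ℝ) := Finset.sum_le_sum fun y _ => by split_ifs <;> norm_num
      _ = _ := by
        rw [Finset.sum_const, nsmul_eq_mul, mul_one, ← Finset.card_erase_add_one hx]; push_cast; ring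
  calc _ ≤ ∑ x ∈ X, ((X.card : ℝ) - 1) := Finset.sum_le_sum this
    _ = _ := by rw [Finset.sum_const, nsmul_eq_mul]

lemma trim_step {n : ℕ} (G : SimpleGraph (Fin n)) (p : ℝ) (X : Finset (Fin n)) (m : ℕ)
    (hc : X.card = m + 1) (hm : 1 ≤ m)
    (h : eCount G X X ≤ p * (X.card * (X.card - 1))) :
    ∃ Y ⊆ X, Y.card = m ∧ eCount G Y Y ≤ p * (Y.card * (Y.card - 1)) := by
  classical
  have hne : X.Nonempty := Finset.card_pos.mp (by omega)
  obtain ⟨v, hv, hd⟩ := Finset.exists_le_of_sum_le (s := X)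
    (f := fun _ => eCount G X X / X.card) (g := fun x => eCount G {x} X) hne (by
      rw [Finset.sum_const, nsmul_eq_mul, mul_div_cancel₀]
      · apply le_of_eq; simp [eCount]
      · rw [hc]; positivity)
  refine ⟨X.erase v, Finset.erase_subset _ _, by rw [Finset.card_erase_of_mem hv, hc]; rfl, ?_⟩
  have hdj : Disjoint ({v} : Finset (Fin n)) (X.erase v) := by simp
  have hun : {v} ∪ X.erase v = X := by
    rw [← Finset.insert_eq, Finset.insert_erase hv]
  have h1 := eCount_union G hdj
  rw [hun, eCount_singleton] at h1
  have h2 : eCount G {v} X = eCount G {v} (X.erase v) := by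
    rw [eCount_comm, eCount_comm G {v}]
    conv_lhs => rw [← hun]
    rw [eCount_union_left G hdj, eCount_singleton, zero_add]
  rw [h2] at hd
  have h3 : ((X.erase v).card : ℝ) = m := by rw [Finset.card_erase_of_mem hv, hc]; simp
  rw [h3]
  have hc' : (X.card : ℝ) = m + 1 := by rw [hc]; push_cast; rfl
  rw [hc'] at h hd
  have hm' : (1 : ℝ) ≤ m := by exact_mod_cast hm
  set E := eCount G X X
  have hE : E / (m + 1) * (m + 1) = E := by field_simp
  set t := E / ((m : ℝ) + 1)
  have : eCount G (X.erase v) (X.erase v) ≤ t * (m - 1) := by nlinarith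
  refine this.trans ?_
  have : t ≤ p * m := by
    have : t * (m + 1) ≤ (p * m) * (m + 1) := by rw [hE]; nlinarith
    exact le_of_mul_le_mul_right this (by positivity)
  nlinarith

lemma trim {n : ℕ} (G : SimpleGraph (Fin n)) (p : ℝ) (m : ℕ) (hm : 1 ≤ m) (d : ℕ) :
    ∀ (X : Finset (Fin n)), X.card = m + d →
    eCount G X X ≤ p * (X.card * (X.card - 1)) →
    ∃ Y ⊆ X, Y.card = m ∧ eCount G Y Y ≤ p * (Y.card * (Y.card - 1)) := by
  induction d with
  | zero => intro X h h'; exact ⟨X, subset_rfl, by simpa using h, h'⟩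
  | succ d ih =>
    intro X h h'
    obtain ⟨Y, hY, hc, he⟩ := trim_step G p X (m + d) (by omega) (by omega) h'
    obtain ⟨Z, hZ, hc, he⟩ := ih Y hc he
    exact ⟨Z, hZ.trans hY, hc, he⟩

/-- combining two sparse sets -/
lemma comb {n : ℕ} (G : SimpleGraph (Fin n)) (p η ε : ℝ) (k : ℕ) (hη : 0 < η)
    (hε : 0 < ε) (hp : 2 * ε * k ≤ p * η ^ 2) (A B X Y : Finset (Fin n))
    (hAB : Disjoint A B) (hA : 0 < A.card) (hAB' : A.card ≤ B.card) (hBA : B.card ≤ k * A.card)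
    (he : eCount G A B ≤ ε * (A.card * B.card))
    (hX : X ⊆ A) (hY : Y ⊆ B) (hXc : η * A.card ≤ X.card) (hYc : η * B.card ≤ Y.card)
    (hXe : eCount G X X ≤ (3 / 2 * p) * (X.card * (X.card - 1)))
    (hYe : eCount G Y Y ≤ (3 / 2 * p) * (Y.card * (Y.card - 1))) :
    ∃ Z ⊆ A ∪ B, η * A.card ≤ Z.card ∧ eCount G Z Z ≤ p * (Z.card * (Z.card - 1)) := by
  classical
  have hA' : (0 : ℝ) < A.card := by exact_mod_cast hA
  set m := ⌈η * A.card⌉₊ with hmdef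
  have hm1 : 1 ≤ m := Nat.ceil_pos.mpr (by positivity)
  have hmX : m ≤ X.card := Nat.ceil_le.mpr hXc
  have hmY : m ≤ Y.card := Nat.ceil_le.mpr (le_trans (by gcongr) hYc)
  have hm : η * A.card ≤ m := Nat.le_ceil _
  obtain ⟨X', hX', hXc', hXe'⟩ := trim G _ m hm1 (X.card - m) X (by omega) hXe
  obtain ⟨Y', hY', hYc', hYe'⟩ := trim G _ m hm1 (Y.card - m) Y (by omega) hYe
  have hd : Disjoint X' Y' := hAB.mono (hX'.trans hX) (hY'.trans hY)
  have hcard : ((X' ∪ Y').card : ℝ) = 2 * m := by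
    rw [Finset.card_union_of_disjoint hd, hXc', hYc']; push_cast; ring
  refine ⟨X' ∪ Y', Finset.union_subset_union (hX'.trans hX) (hY'.trans hY), ?_, ?_⟩
  · rw [hcard]; linarith [(Nat.cast_nonneg m : (0 : ℝ) ≤ m)]
  · rw [eCount_union G hd, hcard]
    rw [hXc'] at hXe'
    rw [hYc'] at hYe'
    have h1 : eCount G X' Y' ≤ ε * (A.card * B.card) :=
      (eCount_mono G (hX'.trans hX) (hY'.trans hY)).trans he
    have hBA' : (B.card : ℝ) ≤ k * A.card := by exact_mod_cast hBA
    have h2 : ε * (A.card * B.card) ≤ ε * (A.card * (k * A.card)) := by gcongr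
    have h3 : (2 * ε * k) * (A.card : ℝ) ^ 2 ≤ p * η ^ 2 * (A.card : ℝ) ^ 2 := by gcongr
    have h4 : (η * A.card) ^ 2 ≤ (m : ℝ) ^ 2 := by gcongr
    have hp0 : 0 ≤ p := by
      by_contra hneg
      have : p * η ^ 2 < 0 := mul_neg_of_neg_of_pos (by linarith) (by positivity)
      have : 0 ≤ 2 * ε * k := by positivity
      linarith
    have h5 : p * (η * A.card) ^ 2 ≤ p * (m : ℝ) ^ 2 := by gcongr
    have h6 : 0 ≤ p * m := by positivity
    nlinarith

lemma disj_fam {n : ℕ} (m k : ℕ) : ∀ S : Finset (Fin n), k * m ≤ S.card →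
    ∃ V : ℕ → Finset (Fin n), (∀ j < k, V j ⊆ S ∧ (V j).card = m) ∧
      ∀ i < k, ∀ j < k, i ≠ j → Disjoint (V i) (V j) := by
  classical
  induction k with
  | zero => intro S _; exact ⟨fun _ => ∅, by simp, by simp⟩
  | succ k ih =>
    intro S hS
    have hS' : k * m + m ≤ S.card := by rw [← Nat.succ_mul]; exact hS
    obtain ⟨T, hT, hTc⟩ := Finset.exists_subset_card_eq (s := S) (n := m) (by omega)
    obtain ⟨V, hV, hd⟩ := ih (S \ T) (by rw [Finset.card_sdiff_of_subset hT]; omega)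
    have key : ∀ j < k, Disjoint (V j) T := fun j hj =>
      Finset.disjoint_of_subset_left (hV j hj).1 Finset.sdiff_disjoint
    refine ⟨fun j => if j = k then T else V j, ?_, ?_⟩
    · intro j hj
      by_cases h : j = k
      · simp [h, hT, hTc]
      · simp only [h, if_false]
        exact ⟨(hV j (by omega)).1.trans Finset.sdiff_subset, (hV j (by omega)).2⟩
    · intro i hi j hj hij
      by_cases h : i = k
      · have h' : j ≠ k := by omega
        simp only [h, h', if_true, if_false]
        exact (key j (by omega)).symm
      · by_cases h' : j = k
        · simp only [h, h', if_true, if_false]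
          exact key i (by omega)
        · simp only [h, h', if_false]
          exact hd i (by omega) j (by omega) hij

lemma eCount_le_of {n : ℕ} (G : SimpleGraph (Fin n)) (A B : Finset (Fin n)) (t : ℝ)
    (h : ∀ a ∈ A, eCount G {a} B ≤ t) : eCount G A B ≤ A.card * t := by
  have : eCount G A B = ∑ a ∈ A, eCount G {a} B := by simp [eCount]
  rw [this, ← nsmul_eq_mul, ← Finset.sum_const]
  exact Finset.sum_le_sum h

lemma eCount_single_eq {n : ℕ} (G : SimpleGraph (Fin n)) [DecidableRel G.Adj]
    (a : Fin n) (B : Finset (Fin n)) :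
    eCount G {a} B = (B.filter (fun b => G.Adj a b)).card := by
  simp only [eCount, Finset.sum_singleton]
  rw [Finset.card_filter]
  push_cast
  exact Finset.sum_congr rfl fun b _ => by by_cases h : G.Adj a b <;> simp [h]

/-- a pair of sets, sparse or dense -/
def GoodPair {n : ℕ} (G : SimpleGraph (Fin n)) (S : Finset (Fin n)) (k : ℕ) (ε s : ℝ) : Prop :=
  ∃ A B : Finset (Fin n), A ⊆ S ∧ B ⊆ S ∧ Disjoint A B ∧ s ≤ B.card ∧
    A.card ≤ B.card ∧ B.card ≤ k * A.card ∧
    (eCount G A B ≤ ε * (A.card * B.card) ∨ eCount Gᶜ A B ≤ ε * (A.card * B.card))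

lemma emb_step {n k : ℕ} (G : SimpleGraph (Fin n)) (S : Finset (Fin n)) (H : SimpleGraph (Fin k))
    (ε s : ℝ) (hε : 0 < ε)
    (V0 : ℕ → Finset (Fin n)) (hV0 : ∀ j < k, V0 j ⊆ S)
    (hdis : ∀ i < k, ∀ j < k, i ≠ j → Disjoint (V0 i) (V0 j))
    (hno : ¬ GoodPair G S k ε s) (i : Fin k) (m : ℕ) (hms : s ≤ m) (hm : 1 ≤ m)
    (V : Fin k → Finset (Fin n)) (hV : ∀ j, V j ⊆ V0 j)
    (hlt : ∀ j, j < i → (V j).card = 1) (hge : ∀ j, i ≤ j → (V j).card = m)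
    (hadj : ∀ j j', j < i → j < j' → ∀ u ∈ V j, ∀ v ∈ V j', (H.Adj j j' ↔ G.Adj u v)) :
    ∃ V' : Fin k → Finset (Fin n), ∃ m' : ℕ, ε * m ≤ m' ∧ 1 ≤ m' ∧ (∀ j, V' j ⊆ V0 j) ∧
      (∀ j, j ≤ i → (V' j).card = 1) ∧ (∀ j, i < j → (V' j).card = m') ∧
      (∀ j j', j ≤ i → j < j' → ∀ u ∈ V' j, ∀ v ∈ V' j', (H.Adj j j' ↔ G.Adj u v)) := by
  classical
  set N : Fin k → Fin n → Finset (Fin n) := fun j u =>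
    (V j).filter (fun v => H.Adj i j ↔ G.Adj u v) with hN
  have claim : ∃ u ∈ V i, ∀ j, i < j → ε * m ≤ (N j u).card := by
    by_contra hcon
    push Not at hcon
    set Bad : Fin k → Finset (Fin n) := fun j =>
      (V i).filter (fun u => ((N j u).card : ℝ) < ε * m) with hBad
    have hcov : V i ⊆ (Finset.univ.filter (fun j => i < j)).biUnion Bad := by
      intro u hu
      obtain ⟨j, hj, hlt⟩ := hcon u hu
      simp only [Finset.mem_biUnion, Finset.mem_filter, Finset.mem_univ, true_and, hBad]
      exact ⟨j, hj, hu, hlt⟩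
    have hsum : m ≤ ∑ j ∈ Finset.univ.filter (fun j => i < j), (Bad j).card := by
      rw [← hge i le_rfl]
      exact (Finset.card_le_card hcov).trans Finset.card_biUnion_le
    have : ∃ j, i < j ∧ m ≤ k * (Bad j).card := by
      by_contra hc
      push Not at hc
      have h1 : ∑ j ∈ Finset.univ.filter (fun j => i < j), k * (Bad j).card
          ≤ ∑ j ∈ Finset.univ.filter (fun j => i < j), (m - 1) :=
        Finset.sum_le_sum fun j hj => by
          have := hc j (Finset.mem_filter.mp hj).2
          omega
      rw [← Finset.mul_sum, Finset.sum_const, smul_eq_mul] at h1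
      have h2 : (Finset.univ.filter (fun j => i < j)).card ≤ k := by
        simpa using Finset.card_filter_le (Finset.univ : Finset (Fin k)) (fun j => i < j)
      have h3 : k * m ≤ k * (m - 1) :=
        (Nat.mul_le_mul_left k hsum).trans (h1.trans (Nat.mul_le_mul_right _ h2))
      have hk : 0 < k := i.pos
      have := Nat.le_of_mul_le_mul_left h3 hk
      omega
    obtain ⟨j, hij, hj⟩ := this
    apply hno
    have hjm := hge j hij.le
    refine ⟨Bad j, V j, (Finset.filter_subset _ _).trans ((hV i).trans (hV0 i i.2)),
      (hV j).trans (hV0 j j.2), ?_, by rw [hjm]; exact hms, ?_, by rw [hjm]; exact hj, ?_⟩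
    · refine Disjoint.mono ((Finset.filter_subset _ _).trans (hV i)) (hV j)
        (hdis i i.2 j j.2 ?_)
      exact fun h => hij.ne (Fin.ext h)
    · rw [hjm, ← hge i le_rfl]; exact Finset.card_filter_le _ _
    · have hne : ∀ u ∈ V i, ∀ v ∈ V j, u ≠ v := fun u hu v hv =>
        Finset.disjoint_iff_ne.mp (hdis i i.2 j j.2 (fun h => hij.ne (Fin.ext h))) u (hV i hu) v (hV j hv)
      by_cases hH : H.Adj i j
      · left
        have := eCount_le_of G (Bad j) (V j) (ε * m) (fun a ha => by
          rw [eCount_single_eq]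
          have h := (Finset.mem_filter.mp ha).2
          simp only [hN, hH, true_iff] at h
          exact h.le)
        rw [hjm]; linarith
      · right
        have := eCount_le_of Gᶜ (Bad j) (V j) (ε * m) (fun a ha => by
          rw [eCount_single_eq]
          have h := (Finset.mem_filter.mp ha).2
          simp only [hN, hH, false_iff] at h
          refine le_trans ?_ h.le
          norm_cast
          apply Finset.card_le_card
          intro v hv
          rw [Finset.mem_filter, SimpleGraph.compl_adj] at hv
          exact Finset.mem_filter.mpr ⟨hv.1, hv.2.2⟩)
        rw [hjm]; linarith
  obtain ⟨u, hu, hgood⟩ := claim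
  set m' := ⌈ε * m⌉₊ with hm'
  have hW : ∀ j, ∃ W ⊆ N j u, i < j → W.card = m' := by
    intro j
    by_cases hj : i < j
    · obtain ⟨W, hW, hc⟩ := Finset.exists_subset_card_eq (s := N j u) (n := m')
        (Nat.ceil_le.mpr (hgood j hj))
      exact ⟨W, hW, fun _ => hc⟩
    · exact ⟨∅, by simp, fun h => absurd h hj⟩
  choose W hWs hWc using hW
  have hm0 : (0 : ℝ) < m := by exact_mod_cast hm
  have hWV : ∀ j, W j ⊆ V j := fun j => (hWs j).trans (Finset.filter_subset _ _)
  refine ⟨fun j => if j < i then V j else if j = i then {u} else W j, m', Nat.le_ceil _,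
    Nat.ceil_pos.mpr (by positivity), ?_, ?_, ?_, ?_⟩
  · intro j
    dsimp only
    split_ifs with h1 h2
    · exact hV j
    · subst h2; simpa using hV j hu
    · exact (hWV j).trans (hV j)
  · intro j hj
    dsimp only
    split_ifs with h1 h2
    · exact hlt j h1
    · simp
    · exact absurd (lt_of_le_of_ne hj h2) h1
  · intro j hj
    simp only [hj.not_gt, hj.ne', if_false]
    exact hWc j hj
  · intro j j' hj hjj' a ha b hb
    have hsub : (if j' < i then V j' else if j' = i then {u} else W j') ⊆ V j' := by
      split_ifs with h1 h2
      · exact subset_rfl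
      · subst h2; simpa using hu
      · exact hWV j'
    by_cases h : j < i
    · simp only [h, if_true] at ha
      exact hadj j j' h hjj' a ha b (hsub hb)
    · have hji : j = i := le_antisymm hj (not_lt.mp h)
      subst hji
      simp only [lt_irrefl, if_false, if_true, Finset.mem_singleton] at ha
      subst ha
      simp only [hjj'.not_gt, hjj'.ne', if_false] at hb
      exact (Finset.mem_filter.mp (hWs j' hb)).2

lemma emb_all {n k : ℕ} (G : SimpleGraph (Fin n)) (S : Finset (Fin n)) (H : SimpleGraph (Fin k))
    (ε s : ℝ) (hε : 0 < ε) (hε1 : ε ≤ 1) (m0 : ℕ) (hm0 : 1 ≤ m0) (hs : s ≤ ε ^ k * m0)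
    (V0 : ℕ → Finset (Fin n)) (hV0 : ∀ j < k, V0 j ⊆ S ∧ (V0 j).card = m0)
    (hdis : ∀ i < k, ∀ j < k, i ≠ j → Disjoint (V0 i) (V0 j))
    (hno : ¬ GoodPair G S k ε s) (i : ℕ) (hi : i ≤ k) :
    ∃ V : Fin k → Finset (Fin n), ∃ m : ℕ, ε ^ i * m0 ≤ m ∧ 1 ≤ m ∧ (∀ j, V j ⊆ V0 j) ∧
      (∀ j : Fin k, j.1 < i → (V j).card = 1) ∧ (∀ j : Fin k, i ≤ j.1 → (V j).card = m) ∧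
      (∀ j j' : Fin k, j.1 < i → j < j' → ∀ u ∈ V j, ∀ v ∈ V j', (H.Adj j j' ↔ G.Adj u v)) := by
  induction i with
  | zero =>
    refine ⟨fun j => V0 j, m0, by simp, hm0, fun j => subset_rfl, by simp,
      fun j _ => (hV0 j j.2).2, by simp⟩
  | succ i ih =>
    obtain ⟨V, m, h1, h2, h3, h4, h5, h6⟩ := ih (by omega)
    have hpow : ε ^ k * m0 ≤ ε ^ i * m0 := by
      have := pow_le_pow_of_le_one hε.le hε1 (show i ≤ k by omega)
      gcongr
    obtain ⟨V', m', g1, g2, g3, g4, g5, g6⟩ := emb_step G S H ε s hε V0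
      (fun j hj => (hV0 j hj).1) hdis hno ⟨i, by omega⟩ m (hs.trans (hpow.trans h1)) h2 V h3
      (fun j hj => h4 j hj) (fun j hj => h5 j hj) (fun j j' hj => h6 j j' hj)
    refine ⟨V', m', ?_, g2, g3, fun j hj => g4 j (Fin.le_def.mpr (by simp; omega)),
      fun j hj => g5 j (Fin.lt_def.mpr (by simp; omega)),
      fun j j' hj => g6 j j' (Fin.le_def.mpr (by simp; omega))⟩
    calc ε ^ (i + 1) * m0 = ε * (ε ^ i * m0) := by ring
      _ ≤ ε * m := by gcongr
      _ ≤ m' := g1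

lemma pair_lemma {n k : ℕ} (G : SimpleGraph (Fin n)) (S : Finset (Fin n))
    (H : SimpleGraph (Fin k)) (hH : ¬ Embeds ⟨k, H⟩ ⟨n, G⟩) (hk : 1 ≤ k) (hS : k ≤ S.card)
    (ε : ℝ) (hε : 0 < ε) (hε1 : ε ≤ 1) :
    GoodPair G S k ε (ε ^ k / (2 * k) * S.card) := by
  by_contra hno
  set m0 := S.card / k with hm
  have hm0 : 1 ≤ m0 := Nat.div_pos hS hk
  obtain ⟨V0, hV0, hdis⟩ := disj_fam m0 k S (Nat.mul_div_le _ _)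
  have hk' : (0 : ℝ) < k := by exact_mod_cast hk
  have hlt : S.card ≤ 2 * k * m0 := by
    have := Nat.lt_mul_div_succ S.card hk
    rw [← hm] at this
    nlinarith
  have hlt' : (S.card : ℝ) ≤ 2 * k * m0 := by exact_mod_cast hlt
  obtain ⟨V, m, h1, h2, h3, h4, h5, h6⟩ := emb_all G S H ε _ hε hε1 m0 hm0 (by
    calc ε ^ k / (2 * k) * S.card ≤ ε ^ k / (2 * k) * (2 * k * m0) := by gcongr
      _ = ε ^ k * m0 := by field_simp) V0 hV0 hdis hno k le_rfl
  have : ∀ j, ∃ v, v ∈ V j := fun j =>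
    Finset.card_pos.mp (by rw [h4 j j.2]; exact one_pos)
  choose f hf using this
  have hinj : Function.Injective f := by
    intro a b hab
    by_contra hne
    exact Finset.disjoint_iff_ne.mp (hdis a a.2 b b.2 (fun h => hne (Fin.ext h)))
      (f a) (h3 a (hf a)) (f b) (h3 b (hf b)) hab
  refine hH ⟨f, hinj, ?_⟩
  intro a b
  rcases lt_trichotomy a b with h | h | h
  · exact h6 a b a.2 h _ (hf a) _ (hf b)
  · subst h; simp
  · have := h6 b a b.2 h _ (hf b) _ (hf a)
    dsimp only
    rw [H.adj_comm, G.adj_comm]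
    exact this

/-- density version of Rödl's theorem -/
def RodlD {k : ℕ} (H : SimpleGraph (Fin k)) (p q : ℝ) : Prop :=
  ∃ δ : ℝ, 0 < δ ∧ δ ≤ 1 ∧ ∀ (n : ℕ) (G : SimpleGraph (Fin n)), ¬ Embeds ⟨k, H⟩ ⟨n, G⟩ →
    ∀ S : Finset (Fin n), S.Nonempty → ∃ X ⊆ S, δ * S.card ≤ X.card ∧
      (eCount G X X ≤ p * (X.card * (X.card - 1)) ∨ eCount Gᶜ X X ≤ q * (X.card * (X.card - 1)))

lemma RodlD_step {k : ℕ} (hk : 1 ≤ k) (H : SimpleGraph (Fin k)) (p q : ℝ) (hp : 0 < p) (hq : 0 < q)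
    (h1 : RodlD H (3 / 2 * p) q) (h2 : RodlD H p (3 / 2 * q)) : RodlD H p q := by
  obtain ⟨η₁, hη₁, hη₁', h1⟩ := h1
  obtain ⟨η₂, hη₂, hη₂', h2⟩ := h2
  obtain ⟨η, hη, hηle1, hηle2⟩ : ∃ η : ℝ, 0 < η ∧ η ≤ η₁ ∧ η ≤ η₂ :=
    ⟨min η₁ η₂, lt_min hη₁ hη₂, min_le_left _ _, min_le_right _ _⟩
  have hk' : (1 : ℝ) ≤ k := by exact_mod_cast hk
  obtain ⟨ε, hε, hε1, hεp, hεq⟩ : ∃ ε : ℝ, 0 < ε ∧ ε ≤ 1 ∧ 2 * ε * k ≤ p * η ^ 2 ∧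
      2 * ε * k ≤ q * η ^ 2 := by
    refine ⟨min 1 (min (p * η ^ 2 / (2 * k)) (q * η ^ 2 / (2 * k))), by positivity,
      min_le_left _ _, ?_, ?_⟩
    · have : min 1 (min (p * η ^ 2 / (2 * k)) (q * η ^ 2 / (2 * k))) ≤ p * η ^ 2 / (2 * k) :=
        (min_le_right _ _).trans (min_le_left _ _)
      rw [le_div_iff₀ (by positivity)] at this
      linarith
    · have : min 1 (min (p * η ^ 2 / (2 * k)) (q * η ^ 2 / (2 * k))) ≤ q * η ^ 2 / (2 * k) :=
        (min_le_right _ _).trans (min_le_right _ _)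
      rw [le_div_iff₀ (by positivity)] at this
      linarith
  set δ' := ε ^ k / (2 * k) with hδ'
  have hδ'0 : 0 < δ' := by positivity
  refine ⟨min (1 / k) (η * δ' / k), by positivity, (min_le_left _ _).trans (by
    rw [div_le_one (by positivity)]; exact hk'), ?_⟩
  intro n G hG S hS
  by_cases hSk : S.card < k
  · obtain ⟨v, hv⟩ := hS
    refine ⟨{v}, by simpa using hv, ?_, Or.inl ?_⟩
    · calc _ ≤ 1 / (k : ℝ) * S.card := by gcongr; exact min_le_left _ _
        _ ≤ 1 / (k : ℝ) * k := by gcongr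
        _ = _ := by simp; field_simp
    · rw [eCount_singleton]; simp
  · obtain ⟨A, B, hA, hB, hdj, hBc, hAB, hBA, he⟩ :=
      pair_lemma G S H hG hk (not_lt.mp hSk) ε hε hε1
    have hS0 : (0 : ℝ) < S.card := by exact_mod_cast hS.card_pos
    have hB0 : 0 < B.card := by
      have : (0 : ℝ) < B.card := lt_of_lt_of_le (by positivity) hBc
      exact_mod_cast this
    have hA0 : 0 < A.card := by
      by_contra h
      have : A.card = 0 := by omega
      rw [this] at hBA; omega
    have hBA' : (B.card : ℝ) ≤ k * A.card := by exact_mod_cast hBA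
    have hAB' : (A.card : ℝ) ≤ B.card := by exact_mod_cast hAB
    have hbase : min (1 / (k : ℝ)) (η * δ' / k) * S.card ≤ η * A.card := by
      calc _ ≤ η * δ' / k * S.card := by gcongr; exact min_le_right _ _
        _ = η / k * (δ' * S.card) := by ring
        _ ≤ η / k * (k * A.card) := 
          mul_le_mul_of_nonneg_left (hBc.trans hBA') (by positivity)
        _ = _ := by field_simp
    have hbaseB : min (1 / (k : ℝ)) (η * δ' / k) * S.card ≤ η * B.card :=
      hbase.trans (by gcongr)
    have hAne := Finset.card_pos.mp hA0
    have hBne := Finset.card_pos.mp hB0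
    rcases he with he | he
    · obtain ⟨X, hX, hXc, hXe⟩ := h1 n G hG A hAne
      obtain ⟨Y, hY, hYc, hYe⟩ := h1 n G hG B hBne
      have hXc' : η * A.card ≤ X.card := le_trans (by gcongr) hXc
      have hYc' : η * B.card ≤ Y.card := le_trans (by gcongr) hYc
      rcases hXe with hXe | hXe
      · rcases hYe with hYe | hYe
        · obtain ⟨Z, hZ, hZc, hZe⟩ := comb G p η ε k hη hε hεp A B X Y hdj hA0 hAB hBA he hX hY
            hXc' hYc' hXe hYe
          exact ⟨Z, hZ.trans (Finset.union_subset hA hB), hbase.trans hZc, Or.inl hZe⟩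
        · exact ⟨Y, hY.trans hB, hbaseB.trans hYc', Or.inr hYe⟩
      · exact ⟨X, hX.trans hA, hbase.trans hXc', Or.inr hXe⟩
    · obtain ⟨X, hX, hXc, hXe⟩ := h2 n G hG A hAne
      obtain ⟨Y, hY, hYc, hYe⟩ := h2 n G hG B hBne
      have hXc' : η * A.card ≤ X.card := le_trans (by gcongr) hXc
      have hYc' : η * B.card ≤ Y.card := le_trans (by gcongr) hYc
      rcases hXe with hXe | hXe
      · exact ⟨X, hX.trans hA, hbase.trans hXc', Or.inl hXe⟩
      · rcases hYe with hYe | hYe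
        · exact ⟨Y, hY.trans hB, hbaseB.trans hYc', Or.inl hYe⟩
        · obtain ⟨Z, hZ, hZc, hZe⟩ := comb Gᶜ q η ε k hη hε hεq A B X Y hdj hA0 hAB hBA he hX hY
            hXc' hYc' hXe hYe
          exact ⟨Z, hZ.trans (Finset.union_subset hA hB), hbase.trans hZc, Or.inr hZe⟩

lemma RodlD_all {k : ℕ} (hk : 1 ≤ k) (H : SimpleGraph (Fin k)) (a b : ℕ) :
    RodlD H ((2 / 3) ^ a) ((2 / 3) ^ b) := by
  induction a generalizing b with
  | zero =>
    exact ⟨1, one_pos, le_rfl, fun n G _ S _ => ⟨S, subset_rfl, by simp, Or.inl (by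
      simpa using eCount_le G S)⟩⟩
  | succ a iha =>
    induction b with
    | zero =>
      exact ⟨1, one_pos, le_rfl, fun n G _ S _ => ⟨S, subset_rfl, by simp, Or.inr (by
        simpa using eCount_le Gᶜ S)⟩⟩
    | succ b ihb =>
      apply RodlD_step hk H _ _ (by positivity) (by positivity)
      · have := iha (b + 1)
        convert this using 1
        ring
      · convert ihb using 1
        ring

lemma low_deg {n : ℕ} (G : SimpleGraph (Fin n)) (p : ℝ) (hp : 0 < p) (X : Finset (Fin n))
    (hX : X.Nonempty) (h : eCount G X X ≤ p * (X.card * (X.card - 1))) :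
    ∃ Y ⊆ X, (X.card : ℝ) / 2 ≤ Y.card ∧ ∀ y ∈ Y, eCount G {y} Y ≤ 4 * p * Y.card := by
  classical
  set Y := X.filter (fun x => eCount G {x} X ≤ 2 * p * X.card) with hY
  have hX0 : (0 : ℝ) < X.card := by exact_mod_cast hX.card_pos
  have hc : (X.card : ℝ) / 2 ≤ Y.card := by
    set Z := X.filter (fun x => ¬ eCount G {x} X ≤ 2 * p * X.card) with hZ
    have h1 : Y.card + Z.card = X.card := Finset.card_filter_add_card_filter_not _
    have h1' : (Y.card : ℝ) + Z.card = X.card := by exact_mod_cast h1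
    have h2 : Z.card * (2 * p * X.card) ≤ eCount G Z X := by
      have : eCount G Z X = ∑ a ∈ Z, eCount G {a} X := by simp [eCount]
      rw [this, ← nsmul_eq_mul, ← Finset.sum_const]
      exact Finset.sum_le_sum fun z hz => (not_le.mp (Finset.mem_filter.mp hz).2).le
    have h3 := eCount_mono G (Finset.filter_subset _ _ : Z ⊆ X) (subset_rfl : X ⊆ X)
    have h4 : (p * X.card) * (2 * Z.card) ≤ (p * X.card) * X.card := by nlinarith
    have h5 := le_of_mul_le_mul_left h4 (by positivity)
    linarith
  refine ⟨Y, Finset.filter_subset _ _, hc, fun y hy => ?_⟩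
  have h1 := (Finset.mem_filter.mp hy).2
  have h2 := eCount_mono G (subset_rfl : ({y} : Finset (Fin n)) ⊆ {y}) (Finset.filter_subset _ _ : Y ⊆ X)
  nlinarith

theorem rodl {k : ℕ} (hk : 1 ≤ k) (H : SimpleGraph (Fin k)) (ε : ℝ) (hε : 0 < ε) :
    ∃ δ : ℝ, 0 < δ ∧ δ ≤ 1 ∧ ∀ (n : ℕ) (G : SimpleGraph (Fin n)), 1 ≤ n →
      ¬ Embeds ⟨k, H⟩ ⟨n, G⟩ → ∃ X : Finset (Fin n), δ * n ≤ X.card ∧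
      ((∀ x ∈ X, eCount G {x} X < ε * X.card) ∨ (∀ x ∈ X, eCount Gᶜ {x} X < ε * X.card)) := by
  obtain ⟨a, ha⟩ := exists_pow_lt_of_lt_one (show 0 < ε / 8 by positivity)
    (show (2 / 3 : ℝ) < 1 by norm_num)
  obtain ⟨δ, hδ, hδ1, h⟩ := RodlD_all hk H a a
  refine ⟨δ / 2, by positivity, by linarith, ?_⟩
  intro n G hn hG
  have hn' : (0 : ℝ) < n := by exact_mod_cast hn
  obtain ⟨X, -, hXc, hXe⟩ := h n G hG Finset.univ
    (Finset.card_pos.mp (by rw [Finset.card_univ, Fintype.card_fin]; exact hn))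
  rw [Finset.card_univ, Fintype.card_fin] at hXc
  have hX0 : (0 : ℝ) < X.card := lt_of_lt_of_le (by positivity) hXc
  have hXne : X.Nonempty := Finset.card_pos.mp (by exact_mod_cast hX0)
  rcases hXe with hXe | hXe
  all_goals
    obtain ⟨Y, hY, hYc, hYd⟩ := low_deg _ _ (by positivity) X hXne hXe
    have hY0 : (0 : ℝ) < Y.card := by linarith
    refine ⟨Y, by linarith, ?_⟩
  · exact Or.inl fun y hy => (hYd y hy).trans_lt (by gcongr; linarith)
  · exact Or.inr fun y hy => (hYd y hy).trans_lt (by gcongr; linarith)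

/-- clique number of a graph on `Fin n` -/
noncomputable def cl {n : ℕ} (G : SimpleGraph (Fin n)) : ℕ :=
  sSup {k | ∃ s : Finset (Fin n), G.IsNClique k s}

lemma cl_bdd {n : ℕ} (G : SimpleGraph (Fin n)) :
    BddAbove {k | ∃ s : Finset (Fin n), G.IsNClique k s} := by
  refine ⟨n, ?_⟩
  rintro k ⟨s, hs⟩
  rw [← hs.card_eq]
  simpa using Finset.card_le_univ s

lemma le_cl {n : ℕ} (G : SimpleGraph (Fin n)) (s : Finset (Fin n)) (hs : G.IsClique s) :
    s.card ≤ cl G :=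
  le_csSup (cl_bdd G) ⟨s, hs, rfl⟩

lemma exists_cl {n : ℕ} (G : SimpleGraph (Fin n)) :
    ∃ s : Finset (Fin n), G.IsNClique (cl G) s :=
  Nat.sSup_mem (s := {k | ∃ s : Finset (Fin n), G.IsNClique k s})
    ⟨0, ∅, by simp [SimpleGraph.isNClique_iff]⟩ (cl_bdd G)

/-- induced subgraph on a finset, relabelled -/
noncomputable def subG {n : ℕ} (G : SimpleGraph (Fin n)) (A : Finset (Fin n)) :
    SimpleGraph (Fin A.card) :=
  G.comap (A.orderEmbOfFin rfl)

lemma subG_compl {n : ℕ} (G : SimpleGraph (Fin n)) (A : Finset (Fin n)) :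
    (subG G A)ᶜ = subG Gᶜ A := by
  ext a b
  simp [subG]

lemma subG_embeds {n : ℕ} (G : SimpleGraph (Fin n)) (A : Finset (Fin n)) :
    Embeds ⟨A.card, subG G A⟩ ⟨n, G⟩ :=
  ⟨A.orderEmbOfFin rfl, (A.orderEmbOfFin rfl).injective, fun _ _ => Iff.rfl⟩

lemma exists_cl_sub {n : ℕ} (G : SimpleGraph (Fin n)) (A : Finset (Fin n)) :
    ∃ s ⊆ A, G.IsClique (s : Set (Fin n)) ∧ s.card = cl (subG G A) := by
  classical
  obtain ⟨s, hs⟩ := exists_cl (subG G A)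
  refine ⟨s.map (A.orderEmbOfFin rfl).toEmbedding, ?_, ?_, ?_⟩
  · intro x hx
    obtain ⟨y, -, rfl⟩ := Finset.mem_map.mp hx
    exact A.orderEmbOfFin_mem rfl y
  · intro x hx y hy hxy
    obtain ⟨x, hx1, rfl⟩ := Finset.mem_map.mp (Finset.mem_coe.mp hx)
    obtain ⟨y, hy1, rfl⟩ := Finset.mem_map.mp (Finset.mem_coe.mp hy)
    exact hs.isClique (Finset.mem_coe.mpr hx1) (Finset.mem_coe.mpr hy1) (fun h => hxy (by rw [h]))
  · rw [Finset.card_map, hs.card_eq]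

lemma cl_sub_le {n : ℕ} (G : SimpleGraph (Fin n)) (A : Finset (Fin n)) :
    cl (subG G A) ≤ cl G := by
  obtain ⟨s, -, hs, hc⟩ := exists_cl_sub G A
  rw [← hc]; exact le_cl G s hs

lemma cl_sub_add {n : ℕ} (G : SimpleGraph (Fin n)) (A B : Finset (Fin n)) (hd : Disjoint A B)
    (h : ∀ a ∈ A, ∀ b ∈ B, G.Adj a b) : cl (subG G A) + cl (subG G B) ≤ cl G := by
  classical
  obtain ⟨s, hsA, hs, hc⟩ := exists_cl_sub G A
  obtain ⟨t, htB, ht, hc'⟩ := exists_cl_sub G B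
  rw [← hc, ← hc', ← Finset.card_union_of_disjoint (hd.mono hsA htB)]
  apply le_cl
  intro x hx y hy hxy
  rcases Finset.mem_union.mp (Finset.mem_coe.mp hx) with hx | hx <;>
  rcases Finset.mem_union.mp (Finset.mem_coe.mp hy) with hy | hy
  · exact hs hx hy hxy
  · exact h x (hsA hx) y (htB hy)
  · exact (h y (hsA hy) x (htB hx)).symm
  · exact ht hx hy hxy

lemma one_le_cl {n : ℕ} (hn : 1 ≤ n) (G : SimpleGraph (Fin n)) : 1 ≤ cl G := by
  have := le_cl G {⟨0, hn⟩} (by simp)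
  simpa using this

lemma two_le_cl_of_adj {n : ℕ} (G : SimpleGraph (Fin n)) (a b : Fin n) (h : G.Adj a b) :
    2 ≤ cl G := by
  classical
  have := le_cl G {a, b} (by
    simp only [Finset.coe_insert, Finset.coe_singleton]
    rw [SimpleGraph.isClique_pair]
    exact fun _ => h)
  rwa [Finset.card_pair h.ne] at this

lemma two_le_mul {n : ℕ} (hn : 2 ≤ n) (G : SimpleGraph (Fin n)) : 2 ≤ cl G * cl Gᶜ := by
  have h1 := one_le_cl (by omega) G
  have h2 := one_le_cl (by omega) Gᶜ
  have hne : (⟨0, by omega⟩ : Fin n) ≠ ⟨1, by omega⟩ := by simp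
  by_cases h : G.Adj ⟨0, by omega⟩ ⟨1, by omega⟩
  · have := two_le_cl_of_adj G _ _ h
    nlinarith
  · have := two_le_cl_of_adj Gᶜ _ _ ((SimpleGraph.compl_adj _ _ _).mpr ⟨hne, h⟩)
    nlinarith

lemma ncard_sub_le {n : ℕ} (G : SimpleGraph (Fin n)) (X : Finset (Fin n)) (v : Fin X.card) :
    (((subG G X).neighborSet v).ncard : ℝ) ≤ eCount G {X.orderEmbOfFin rfl v} X := by
  classical
  rw [eCount_single_eq]
  norm_cast
  rw [← Set.ncard_image_of_injective _ (X.orderEmbOfFin rfl).injective]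
  refine le_trans (Set.ncard_le_ncard ?_ (Finset.finite_toSet _)) (Set.ncard_coe_finset _).le
  rintro _ ⟨w, hw, rfl⟩
  rw [Finset.mem_coe, Finset.mem_filter]
  exact ⟨X.orderEmbOfFin_mem rfl w, hw⟩

/-- the inductive step, sparse case -/
lemma sparse_step (J : Set GraphOn) (hJ : IsIdeal J) (ε c₀ c δ τ : ℝ) (hε : 0 < ε)
    (hc₀ : 0 < c₀) (hc : 0 < c) (hcc : c ≤ c₀ / 2) (hδ : 0 < δ)
    (hτ : 0 < τ) (hτ1 : τ ≤ ε * δ) (hτ2 : τ ≤ δ ^ 2) (hτ3 : τ ≤ 1 / 2) (hτc : 1 / 2 ≤ τ ^ c)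
    (hyp : ∀ G ∈ J, Coherent G.2 ε → (G.1 : ℝ) ^ c₀ ≤ (cl G.2 * cl G.2ᶜ : ℕ))
    (n : ℕ) (G : SimpleGraph (Fin n)) (hG : (⟨n, G⟩ : GraphOn) ∈ J) (hn : 1 < τ * n)
    (ih : ∀ m < n, ∀ K : SimpleGraph (Fin m), (⟨m, K⟩ : GraphOn) ∈ J →
      (m : ℝ) ^ c ≤ (cl K * cl Kᶜ : ℕ))
    (X : Finset (Fin n)) (hX : δ * n ≤ X.card)
    (hdeg : ∀ x ∈ X, eCount G {x} X < ε * X.card) :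
    (n : ℝ) ^ c ≤ (cl G * cl Gᶜ : ℕ) := by
  have hn0 : (0 : ℝ) < n := by
    by_contra h
    have : (n : ℝ) = 0 := le_antisymm (not_lt.mp h) (Nat.cast_nonneg _)
    rw [this] at hn; norm_num at hn
  have hn1 : (1 : ℝ) ≤ n := by nlinarith
  have hsq : (n : ℝ) < (δ * n) ^ 2 := by
    have : 1 < δ ^ 2 * n := hn.trans_le (by gcongr)
    nlinarith
  have hδn1 : 1 < δ * n := by
    by_contra h
    have h0 : 0 < δ * n := by positivity
    nlinarith
  have hX2 : 2 ≤ X.card := by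
    have : (1 : ℝ) < X.card := hδn1.trans_le hX
    exact_mod_cast this
  set K := subG G X with hK
  have hKJ : (⟨X.card, K⟩ : GraphOn) ∈ J := hJ _ hG _ (subG_embeds G X)
  have hω : cl K ≤ cl G := cl_sub_le G X
  have hα : cl Kᶜ ≤ cl Gᶜ := by rw [hK, subG_compl]; exact cl_sub_le Gᶜ X
  have hle : ((cl K * cl Kᶜ : ℕ) : ℝ) ≤ (cl G * cl Gᶜ : ℕ) := by
    exact_mod_cast Nat.mul_le_mul hω hα
  by_cases hcoh : Coherent K ε
  · refine le_trans ?_ ((hyp _ hKJ hcoh).trans hle)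
    calc (n : ℝ) ^ c ≤ (n : ℝ) ^ (c₀ / 2) := Real.rpow_le_rpow_of_exponent_le hn1 hcc
      _ ≤ ((δ * n) ^ 2) ^ (c₀ / 2) := Real.rpow_le_rpow hn0.le hsq.le (by positivity)
      _ = (δ * n) ^ c₀ := by
        rw [← Real.rpow_natCast, ← Real.rpow_mul (by positivity)]
        congr 1; push_cast; ring
      _ ≤ _ := Real.rpow_le_rpow (by positivity) hX hc₀.le
  · refine le_trans ?_ hle
    have : ∃ A B : Finset (Fin X.card), Disjoint A B ∧ (∀ a ∈ A, ∀ b ∈ B, ¬ K.Adj a b) ∧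
        ε * X.card ≤ min (A.card : ℝ) B.card := by
      by_contra hcon
      push Not at hcon
      exact hcoh ⟨hX2, fun v => (ncard_sub_le G X v).trans_lt
        (hdeg _ (X.orderEmbOfFin_mem rfl v)), fun A B h1 h2 => hcon A B h1 h2⟩
    obtain ⟨A, B, hd, hanti, hmin⟩ := this
    have hX0 : (0 : ℝ) < X.card := by linarith
    have hεX : 0 < ε * X.card := by positivity
    have hAr : ε * X.card ≤ A.card := hmin.trans (min_le_left _ _)
    have hBr : ε * X.card ≤ B.card := hmin.trans (min_le_right _ _)
    have hA0 : 0 < A.card := by exact_mod_cast hεX.trans_le hAr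
    have hB0 : 0 < B.card := by exact_mod_cast hεX.trans_le hBr
    have hABc : A.card + B.card ≤ X.card := by
      rw [← Finset.card_union_of_disjoint hd]
      simpa using Finset.card_le_univ (A ∪ B)
    have hXn : X.card ≤ n := by simpa using Finset.card_le_univ X
    have hadd := cl_sub_add Kᶜ A B hd (fun a ha b hb => by
      rw [SimpleGraph.compl_adj]
      exact ⟨Finset.disjoint_iff_ne.mp hd a ha b hb, hanti a ha b hb⟩)
    have hwA := cl_sub_le K A
    have hwB := cl_sub_le K B
    have key : ∀ A : Finset (Fin X.card), ε * X.card ≤ A.card → A.card < n →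
        (n : ℝ) ^ c / 2 ≤ cl (subG K A) * cl (subG Kᶜ A) := by
      intro A hA hAn
      have := ih A.card hAn (subG K A) (hJ _ hKJ _ (subG_embeds K A))
      rw [subG_compl] at this
      push_cast at this
      refine le_trans ?_ this
      calc (n : ℝ) ^ c / 2 = 1 / 2 * (n : ℝ) ^ c := by ring
        _ ≤ τ ^ c * (n : ℝ) ^ c := by gcongr
        _ = (τ * n) ^ c := (Real.mul_rpow hτ.le hn0.le).symm
        _ ≤ _ := by
          refine Real.rpow_le_rpow (by positivity) ?_ hc.le
          calc τ * n ≤ ε * δ * n := by gcongr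
            _ = ε * (δ * n) := by ring
            _ ≤ ε * X.card := by gcongr
            _ ≤ _ := hA
    have kA := key A hAr (by omega)
    have kB := key B hBr (by omega)
    have hwA' : (cl (subG K A) : ℝ) ≤ cl K := by exact_mod_cast hwA
    have hwB' : (cl (subG K B) : ℝ) ≤ cl K := by exact_mod_cast hwB
    have hadd' : (cl (subG Kᶜ A) : ℝ) + cl (subG Kᶜ B) ≤ cl Kᶜ := by exact_mod_cast hadd
    push_cast
    calc (n : ℝ) ^ c ≤ cl (subG K A) * cl (subG Kᶜ A) + cl (subG K B) * cl (subG Kᶜ B) := by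
          linarith
      _ ≤ cl K * cl (subG Kᶜ A) + cl K * cl (subG Kᶜ B) := by gcongr
      _ = cl K * (cl (subG Kᶜ A) + cl (subG Kᶜ B)) := by ring
      _ ≤ cl K * cl Kᶜ := by gcongr

lemma exists_c (c₀ τ : ℝ) (hc₀ : 0 < c₀) (hτ : 0 < τ) (hτ1 : τ ≤ 1 / 2) :
    ∃ c : ℝ, 0 < c ∧ c ≤ c₀ / 2 ∧ 1 / 2 ≤ τ ^ c := by
  have hlog : Real.log τ < 0 := Real.log_neg hτ (by linarith)
  have hl2 : 0 < Real.log 2 := Real.log_pos (by norm_num)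
  refine ⟨min (c₀ / 2) (Real.log 2 / (-Real.log τ)), lt_min (by positivity)
    (div_pos hl2 (by linarith)), min_le_left _ _, ?_⟩
  have h := min_le_right (c₀ / 2) (Real.log 2 / (-Real.log τ))
  rw [le_div_iff₀ (by linarith)] at h
  rw [Real.rpow_def_of_pos hτ]
  calc (1 / 2 : ℝ) = Real.exp (-Real.log 2) := by
        rw [Real.exp_neg, Real.exp_log (by norm_num)]; norm_num
    _ ≤ _ := Real.exp_le_exp.mpr (by linarith)

theorem stmt_2 (I : Set GraphOn) (hI : IsIdeal I) (hproper : ∃ H : GraphOn, H ∉ I)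
    (ε c₀ : ℝ) (hε : 0 < ε) (hc₀ : 0 < c₀)
    (hyp : ∀ G ∈ I, (Coherent G.2 ε ∨ Coherent (gCompl G).2 ε) →
      (G.1 : ℝ) ^ c₀ ≤ (gOmega G * gAlpha G : ℕ)) :
    ∃ c : ℝ, 0 < c ∧ ∀ G ∈ I, (G.1 : ℝ) ^ c ≤ (gOmega G * gAlpha G : ℕ) := by
  obtain ⟨⟨k, H⟩, hH⟩ := hproper
  have hfree : ∀ n (G : SimpleGraph (Fin n)), (⟨n, G⟩ : GraphOn) ∈ I →
      ¬ Embeds ⟨k, H⟩ ⟨n, G⟩ := fun n G hG h => hH (hI _ hG _ h)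
  by_cases hk : k = 0
  · subst hk
    refine ⟨1, one_pos, fun G hG => absurd ?_ (hfree G.1 G.2 hG)⟩
    exact ⟨fun a => Fin.elim0 a, fun a => Fin.elim0 a, fun a => Fin.elim0 a⟩
  obtain ⟨δ, hδ, hδ1, hrodl⟩ := rodl (Nat.one_le_iff_ne_zero.mpr hk) H ε hε
  obtain ⟨τ, hτ, hτ1, hτ2, hτ3⟩ : ∃ τ : ℝ, 0 < τ ∧ τ ≤ ε * δ ∧ τ ≤ δ ^ 2 ∧ τ ≤ 1 / 2 :=
    ⟨min (ε * δ) (min (δ ^ 2) (1 / 2)), by positivity, min_le_left _ _,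
      (min_le_right _ _).trans (min_le_left _ _), (min_le_right _ _).trans (min_le_right _ _)⟩
  obtain ⟨c, hc, hcc, hτc⟩ := exists_c c₀ τ hc₀ hτ hτ3
  refine ⟨c, hc, ?_⟩
  suffices hmain : ∀ n, ∀ G : SimpleGraph (Fin n), (⟨n, G⟩ : GraphOn) ∈ I →
      (n : ℝ) ^ c ≤ (cl G * cl Gᶜ : ℕ) from fun G hG => hmain G.1 G.2 hG
  intro n
  induction n using Nat.strong_induction_on with
  | _ n ih =>
  intro G hG
  rcases Nat.lt_or_ge n 2 with hn | hn
  · rcases Nat.lt_or_ge n 1 with h0 | h1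
    · have : n = 0 := by omega
      subst this
      rw [Nat.cast_zero, Real.zero_rpow hc.ne']
      positivity
    · have h1' : n = 1 := by omega
      have := Nat.mul_le_mul (one_le_cl h1 G) (one_le_cl h1 Gᶜ)
      subst h1'
      rw [Nat.cast_one, Real.one_rpow]
      exact_mod_cast this
  · by_cases hτn : 1 < τ * n
    · obtain ⟨X, hX, hdeg⟩ := hrodl n G (by omega) (hfree n G hG)
      rcases hdeg with hdeg | hdeg
      · exact sparse_step I hI ε c₀ c δ τ hε hc₀ hc hcc hδ hτ hτ1 hτ2 hτ3 hτc
          (fun G hG h => hyp G hG (Or.inl h)) n G hG hτn ih X hX hdeg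
      · have := sparse_step {G | gCompl G ∈ I} ?_ ε c₀ c δ τ hε hc₀ hc hcc hδ hτ hτ1 hτ2 hτ3 hτc
          ?_ n Gᶜ (by simpa [gCompl] using hG) hτn ?_ X hX hdeg
        · rwa [compl_compl, mul_comm] at this
        · intro G hG H hHG
          obtain ⟨f, hf, hadj⟩ := hHG
          refine hI _ hG _ ⟨f, hf, fun a b => ?_⟩
          change H.2ᶜ.Adj (a : Fin H.1) (b : Fin H.1) ↔ G.2ᶜ.Adj (f a) (f b)
          have h1 := SimpleGraph.compl_adj H.2 a b
          have h2 := SimpleGraph.compl_adj G.2 (f a) (f b)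
          exact h1.trans (((and_congr (hf.ne_iff (x := a) (y := b)).symm
            (not_congr (hadj a b)))).trans h2.symm)
        · intro K hK hcoh
          have := hyp _ hK (Or.inr (by simpa [gCompl] using hcoh))
          have h2 : gOmega (gCompl K) * gAlpha (gCompl K) = cl K.2 * cl K.2ᶜ := by
            change cl K.2ᶜ * cl K.2ᶜᶜ = _
            rw [compl_compl, mul_comm]
          rw [h2] at this
          exact this
        · intro m hm K hK
          have := ih m hm Kᶜ hK
          rwa [compl_compl, mul_comm] at this
    · have h2 := two_le_mul hn G
      have h2' : (2 : ℝ) ≤ (cl G * cl Gᶜ : ℕ) := by exact_mod_cast h2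
      refine le_trans ?_ h2'
      have h3 : (τ * n) ^ c ≤ 1 := Real.rpow_le_one (by positivity) (not_lt.mp hτn) hc.le
      rw [Real.mul_rpow hτ.le (by positivity)] at h3
      have h4 : (0 : ℝ) ≤ (n : ℝ) ^ c := by positivity
      nlinarith
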